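/- arXiv:1207.0129 — 5 statements merged into one kernel-verified Lean document; each statement's English description precedes it below -/
import Mathlib

section
/- Let n, k ∈ ℕ, let μ > -1 and α be real numbers with n < α ≤ n+1, let T > 0, t₀ ∈ ℝ, and let a₀, …, a_n, b be real numbers. Define the truncated fractional Taylor model x_α(t₀+t) := Σ_{j=0}^{n} (t^j/j!) a_j + (t^α/Γ(α+1)) b for t ≥ 0. Then (n+1)!/T^α · (Γ(α-n)/B(α+1+k, n+μ+2)) · ∫_0^1 (1-τ)^μ τ^k P_{n+1}^{(μ,k)}(τ) x_α(t₀+Tτ) dτ = b, i.e., the minimal Jacobi fractional differentiator applied to the truncated fractional Taylor expansion recovers the fractional derivative coefficient b exactly. -/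
open Real

/-- Generalized binomial coefficient `binom(a, i) = Γ(a+1)/(Γ(i+1) Γ(a-i+1))`. -/
noncomputable def gbinom (a : ℝ) (i : ℕ) : ℝ :=
  Real.Gamma (a + 1) / (Real.Gamma (i + 1) * Real.Gamma (a - i + 1))

/-- Shifted Jacobi polynomial on `[0,1]`. -/
noncomputable def jacobiP (μ k : ℝ) (m : ℕ) (τ : ℝ) : ℝ :=
  ∑ j ∈ Finset.range (m + 1),
    gbinom (m + μ) j * gbinom (m + k) (m - j) * (τ - 1) ^ (m - j) * τ ^ j

/-- Beta function `B(p,q) = Γ(p)Γ(q)/Γ(p+q)`. -/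
noncomputable def betaFn (p q : ℝ) : ℝ :=
  Real.Gamma p * Real.Gamma q / Real.Gamma (p + q)

/-- Chu–Vandermonde for falling factorials over a commutative ring. -/
theorem descPochhammer_eval_add {R : Type*} [CommRing R] (r s : R) (n : ℕ) :
    (descPochhammer R n).eval (r + s) = ∑ j ∈ Finset.range (n + 1),
      (n.choose j : R) * ((descPochhammer R j).eval r * (descPochhammer R (n - j)).eval s) := by
  have key (x : R) (i : ℕ) : (descPochhammer ℤ i).smeval x = (descPochhammer R i).eval x := by
    rw [Polynomial.descPochhammer_smeval_eq_ascPochhammer, Polynomial.ascPochhammer_smeval_eq_eval,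
      descPochhammer_eval_eq_ascPochhammer]
  have h := Ring.descPochhammer_smeval_add n (Commute.all r s)
  rw [Finset.Nat.sum_antidiagonal_eq_sum_range_succ_mk] at h
  simpa only [key] using h

/-- Mixed rising/falling Chu–Vandermonde identity. -/
theorem sum_neg_one_pow_choose_ascPochhammer_descPochhammer {R : Type*} [CommRing R]
    (κ s : R) (m : ℕ) :
    ∑ j ∈ Finset.range (m + 1), (-1) ^ (m - j) * (m.choose j : R) *
      ((ascPochhammer R j).eval (κ + s + 1) * (descPochhammer R (m - j)).eval (m + κ)) =
      (descPochhammer R m).eval s := by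
  have h := descPochhammer_eval_add (-(κ + s + 1)) (m + κ) m
  have hneg (x : R) (i : ℕ) :
      (descPochhammer R i).eval (-x) = (-1) ^ i * (ascPochhammer R i).eval x := by
    have h1 := ascPochhammer_eval_neg_eq_descPochhammer R (-x) i
    rw [neg_neg] at h1
    rw [h1, ← mul_assoc, ← mul_pow]
    simp
  have hl : (descPochhammer R m).eval (-(κ + s + 1) + (m + κ)) =
      (-1) ^ m * (descPochhammer R m).eval s := by
    rw [show -(κ + s + 1) + (m + κ) = -(s - m + 1) by ring, hneg,
      descPochhammer_eval_eq_ascPochhammer R s]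
  rw [hl] at h
  have h2 := congrArg ((-1) ^ m * ·) h
  simp only [← mul_assoc, ← mul_pow, Finset.mul_sum] at h2
  simp only [mul_neg, mul_one, neg_neg, one_pow, one_mul] at h2
  rw [h2]
  refine Finset.sum_congr rfl fun j hj => ?_
  have hjm : j ≤ m := Finset.mem_range_succ_iff.mp hj
  rw [hneg]
  obtain ⟨i, rfl⟩ := Nat.exists_eq_add_of_le hjm
  have hsq : ((-1 : R) ^ j) * (-1) ^ j = 1 := by rw [← mul_pow]; simp
  rw [Nat.add_sub_cancel_left, pow_add]
  linear_combination (-(-1 : R) ^ i * ((j + i).choose j : R) *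
      ((ascPochhammer R j).eval (κ + s + 1) *
        (descPochhammer R i).eval (((j + i : ℕ) : R) + κ))) * hsq

/-- `Γ(z + n) = (z)ₙ Γ(z)` with the rising factorial `(z)ₙ`. -/
theorem Real.Gamma_add_nat_eq_ascPochhammer {z : ℝ} (hz : 0 < z) (n : ℕ) :
    Real.Gamma (z + n) = (ascPochhammer ℝ n).eval z * Real.Gamma z := by
  induction n with
  | zero => simp
  | succ n ih =>
    rw [Nat.cast_succ, ← add_assoc, Real.Gamma_add_one (by positivity), ih,
      ascPochhammer_succ_eval]
    ring

/-- `Γ(z + 1) = z(z - 1)⋯(z - n + 1) Γ(z - n + 1)`. -/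
theorem Real.Gamma_add_one_eq_descPochhammer {z : ℝ} {n : ℕ} (hz : 0 < z - n + 1) :
    Real.Gamma (z + 1) = (descPochhammer ℝ n).eval z * Real.Gamma (z - n + 1) := by
  rw [descPochhammer_eval_eq_ascPochhammer, ← Real.Gamma_add_nat_eq_ascPochhammer hz]
  congr 1
  ring

theorem gbinom_eq_descPochhammer_div_factorial {a : ℝ} {i : ℕ} (h : 0 < a - i + 1) :
    gbinom a i = (descPochhammer ℝ i).eval a / i.factorial := by
  have := (Real.Gamma_pos_of_pos h).ne'
  rw [gbinom, Real.Gamma_add_one_eq_descPochhammer h, Real.Gamma_nat_eq_factorial]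
  field_simp

theorem intervalIntegrable_sum_fun {ι : Type*} (s : Finset ι) {f : ι → ℝ → ℝ} {a b : ℝ}
    (h : ∀ i ∈ s, IntervalIntegrable (f i) MeasureTheory.volume a b) :
    IntervalIntegrable (fun x => ∑ i ∈ s, f i x) MeasureTheory.volume a b := by
  simpa only [Finset.sum_fn] using IntervalIntegrable.sum s h

theorem intervalIntegrable_beta {p q : ℝ} (hp : 0 < p) (hq : 0 < q) :
    IntervalIntegrable (fun τ : ℝ => τ ^ (p - 1) * (1 - τ) ^ (q - 1)) MeasureTheory.volume 0 1 := by
  have h := Complex.betaIntegral_convergent (u := p) (v := q) (by simpa) (by simpa)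
  rw [intervalIntegrable_iff_integrableOn_Ioo_of_le zero_le_one] at h ⊢
  refine MeasureTheory.IntegrableOn.congr_fun
    (f := fun τ : ℝ => RCLike.re ((τ : ℂ) ^ ((p : ℂ) - 1) * (1 - (τ : ℂ)) ^ ((q : ℂ) - 1)))
    h.re (fun τ hτ => ?_) measurableSet_Ioo
  have h1 := Complex.ofReal_cpow hτ.1.le (p - 1)
  have h2 := Complex.ofReal_cpow (sub_pos.2 hτ.2).le (q - 1)
  push_cast at h1 h2
  simp only [← h1, ← h2, ← Complex.ofReal_mul, RCLike.re_to_complex, Complex.ofReal_re]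

theorem integral_eq_betaFn {p q : ℝ} (hp : 0 < p) (hq : 0 < q) :
    ∫ τ in (0 : ℝ)..1, τ ^ (p - 1) * (1 - τ) ^ (q - 1) = betaFn p q := by
  have h := ProbabilityTheory.beta_eq_betaIntegralReal p q hp hq
  rw [ProbabilityTheory.beta] at h
  have h3 : Complex.betaIntegral p q =
      ((∫ τ in (0 : ℝ)..1, τ ^ (p - 1) * (1 - τ) ^ (q - 1) : ℝ) : ℂ) := by
    rw [Complex.betaIntegral, ← intervalIntegral.integral_ofReal]
    refine intervalIntegral.integral_congr fun τ hτ => ?_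
    rw [Set.uIcc_of_le zero_le_one] at hτ
    have h1 := Complex.ofReal_cpow hτ.1 (p - 1)
    have h2 := Complex.ofReal_cpow (sub_nonneg.2 hτ.2) (q - 1)
    push_cast at h1 h2 ⊢
    rw [h1, h2]
  rw [betaFn, h, h3, Complex.ofReal_re]

/-- On `(0, 1)` the weighted Jacobi polynomial times `τ ^ s` is a combination of Beta densities. -/
theorem jacobi_weight_mul_rpow_eq_sum {μ κ s τ : ℝ} (m : ℕ) (hτ : τ ∈ Set.Ioo (0 : ℝ) 1) :
    (1 - τ) ^ μ * τ ^ κ * jacobiP μ κ m τ * τ ^ s =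
      ∑ j ∈ Finset.range (m + 1), gbinom (m + μ) j * gbinom (m + κ) (m - j) * (-1) ^ (m - j) *
        (τ ^ (κ + s + 1 + j - 1) * (1 - τ) ^ (m + μ - j + 1 - 1)) := by
  rw [jacobiP, Finset.mul_sum, Finset.sum_mul]
  refine Finset.sum_congr rfl fun j hj => ?_
  have hjm : j ≤ m := Finset.mem_range_succ_iff.mp hj
  have h1 : τ ^ (κ + s + 1 + j - 1) = τ ^ κ * τ ^ s * τ ^ j := by
    rw [← Real.rpow_natCast, ← Real.rpow_add hτ.1, ← Real.rpow_add hτ.1]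
    congr 1
    ring
  have h2 : (1 - τ) ^ (m + μ - j + 1 - 1) = (1 - τ) ^ μ * (1 - τ) ^ (m - j) := by
    rw [← Real.rpow_natCast, ← Real.rpow_add (sub_pos.2 hτ.2), Nat.cast_sub hjm]
    congr 1
    ring
  have h3 : (τ - 1) ^ (m - j) = (-1) ^ (m - j) * (1 - τ) ^ (m - j) := by
    rw [← mul_pow]
    congr 1
    ring
  rw [h1, h2, h3]
  ring

theorem intervalIntegrable_jacobi_moment {μ κ s : ℝ} (hμ : -1 < μ) (hκ : -1 < κ) (hs : 0 ≤ s)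
    (m : ℕ) :
    IntervalIntegrable (fun τ : ℝ => (1 - τ) ^ μ * τ ^ κ * jacobiP μ κ m τ * τ ^ s)
      MeasureTheory.volume 0 1 := by
  have h : IntervalIntegrable (fun τ : ℝ =>
      ∑ j ∈ Finset.range (m + 1), gbinom (m + μ) j * gbinom (m + κ) (m - j) * (-1) ^ (m - j) *
        (τ ^ (κ + s + 1 + j - 1) * (1 - τ) ^ (m + μ - j + 1 - 1))) MeasureTheory.volume 0 1 := by
    refine intervalIntegrable_sum_fun _ fun j hj => (intervalIntegrable_beta ?_ ?_).const_mul _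
    · have : (0 : ℝ) ≤ j := j.cast_nonneg
      linarith
    · have : (j : ℝ) ≤ m := by exact_mod_cast Finset.mem_range_succ_iff.mp hj
      linarith
  refine h.congr_uIoo fun τ hτ => ?_
  rw [Set.uIoo_of_le zero_le_one] at hτ
  exact (jacobi_weight_mul_rpow_eq_sum m hτ).symm

/-- Moments of the weighted shifted Jacobi polynomials. -/
theorem integral_jacobi_moment {μ κ s : ℝ} (hμ : -1 < μ) (hκ : -1 < κ) (hs : 0 ≤ s) (m : ℕ) :
    ∫ τ in (0 : ℝ)..1, (1 - τ) ^ μ * τ ^ κ * jacobiP μ κ m τ * τ ^ s =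
      (descPochhammer ℝ m).eval s / m.factorial * betaFn (κ + s + 1) (m + μ + 1) := by
  have hp (j : ℕ) : 0 < κ + s + 1 + j := by
    have : (0 : ℝ) ≤ j := j.cast_nonneg
    linarith
  have hq {j : ℕ} (hj : j ∈ Finset.range (m + 1)) : 0 < m + μ - j + 1 := by
    have : (j : ℝ) ≤ m := by exact_mod_cast Finset.mem_range_succ_iff.mp hj
    linarith
  rw [intervalIntegral.integral_congr_Ioo_of_le zero_le_one
      (fun τ hτ => jacobi_weight_mul_rpow_eq_sum m hτ),
    intervalIntegral.integral_finsetSum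
      (fun j hj => (intervalIntegrable_beta (hp j) (hq hj)).const_mul _),
    ← sum_neg_one_pow_choose_ascPochhammer_descPochhammer κ s m, Finset.sum_div, Finset.sum_mul]
  refine Finset.sum_congr rfl fun j hj => ?_
  have hjm : j ≤ m := Finset.mem_range_succ_iff.mp hj
  have hκj : 0 < (m : ℝ) + κ - (m - j : ℕ) + 1 := by
    rw [Nat.cast_sub hjm]
    have : (0 : ℝ) ≤ j := j.cast_nonneg
    linarith
  have hΓq := (Real.Gamma_pos_of_pos (hq hj)).ne'
  have hsum : κ + s + 1 + j + (m + μ - j + 1) = κ + s + 1 + (m + μ + 1) := by ring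
  have hΓs : Real.Gamma (κ + s + 1 + (m + μ + 1)) ≠ 0 := by
    rw [← hsum]
    exact (Real.Gamma_pos_of_pos (add_pos (hp j) (hq hj))).ne'
  rw [intervalIntegral.integral_const_mul, integral_eq_betaFn (hp j) (hq hj),
    gbinom_eq_descPochhammer_div_factorial hκj, gbinom, betaFn, betaFn, hsum,
    Real.Gamma_add_nat_eq_ascPochhammer (by simpa using hp 0), Real.Gamma_nat_eq_factorial,
    Nat.cast_choose ℝ hjm]
  field_simp

/-- The minimal Jacobi fractional differentiator applied to the truncated
fractional Taylor expansion recovers the fractional derivative coefficient `b` exactly. -/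
theorem minimal_jacobi_fractional_differentiator_exact
    (n k : ℕ) (μ α : ℝ) (hμ : -1 < μ) (hα1 : (n : ℝ) < α) (hα2 : α ≤ n + 1)
    (T : ℝ) (hT : 0 < T) (t₀ : ℝ) (a : ℕ → ℝ) (b : ℝ) (xα : ℝ → ℝ)
    (hx : ∀ t : ℝ, 0 ≤ t →
      xα (t₀ + t) = (∑ j ∈ Finset.range (n + 1), t ^ j / (Nat.factorial j) * a j)
        + t ^ α / Real.Gamma (α + 1) * b) :
    (Nat.factorial (n + 1) : ℝ) / T ^ α
        * (Real.Gamma (α - n) / betaFn (α + 1 + k) (n + μ + 2))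
        * ∫ τ in (0 : ℝ)..1,
            (1 - τ) ^ μ * τ ^ k * jacobiP μ k (n + 1) τ * xα (t₀ + T * τ)
      = b := by
  have hκ : (-1 : ℝ) < k := by linarith [(Nat.cast_nonneg k : (0 : ℝ) ≤ k)]
  have hα0 : 0 < α := (Nat.cast_nonneg n).trans_lt hα1
  set w : ℝ → ℝ → ℝ := fun s τ => (1 - τ) ^ μ * τ ^ (k : ℝ) * jacobiP μ k (n + 1) τ * τ ^ s with hw
  have hint {s : ℝ} (hs : 0 ≤ s) : IntervalIntegrable (w s) MeasureTheory.volume 0 1 :=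
    intervalIntegrable_jacobi_moment hμ hκ hs (n + 1)
  have hmom {s : ℝ} (hs : 0 ≤ s) := integral_jacobi_moment hμ hκ hs (n + 1)
  have hexpand : ∫ τ in (0 : ℝ)..1,
      (1 - τ) ^ μ * τ ^ k * jacobiP μ k (n + 1) τ * xα (t₀ + T * τ) =
      ∫ τ in (0 : ℝ)..1, ((∑ j ∈ Finset.range (n + 1), T ^ j / (Nat.factorial j) * a j * w j τ)
        + T ^ α / Real.Gamma (α + 1) * b * w α τ) := by
    refine intervalIntegral.integral_congr fun τ hτ => ?_
    rw [Set.uIcc_of_le zero_le_one] at hτ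
    simp only [hw, Real.rpow_natCast]
    rw [hx _ (mul_nonneg hT.le hτ.1), Real.mul_rpow hT.le hτ.1, mul_add, Finset.mul_sum]
    congr 1
    · refine Finset.sum_congr rfl fun j _ => ?_
      rw [mul_pow]
      ring
    · ring
  have hvanish : ∀ j ∈ Finset.range (n + 1), ∫ τ in (0 : ℝ)..1, w j τ = 0 := fun j hj => by
    rw [hmom j.cast_nonneg, descPochhammer_eval_coe_nat_of_lt (Finset.mem_range.mp hj)]
    simp
  have hαn : 0 < α - n := sub_pos.2 hα1
  have hdesc : Real.Gamma (α + 1) = (descPochhammer ℝ (n + 1)).eval α * Real.Gamma (α - n) := by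
    have hcast : α - (n + 1 : ℕ) + 1 = α - n := by push_cast; ring
    rw [Real.Gamma_add_one_eq_descPochhammer (n := n + 1) (by rwa [hcast]), hcast]
  have hbeta : betaFn (k + α + 1) ((n + 1 : ℕ) + μ + 1) = betaFn (α + 1 + k) (n + μ + 2) := by
    congr 1
    · ring
    · push_cast; ring
  have hB : betaFn (α + 1 + k) (n + μ + 2) ≠ 0 := by
    have h1 : 0 < α + 1 + k := by linarith
    have h2 : 0 < n + μ + 2 := by linarith [(Nat.cast_nonneg n : (0 : ℝ) ≤ n)]
    exact (ProbabilityTheory.beta_pos h1 h2).ne'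
  have hΓ := (Real.Gamma_pos_of_pos hαn).ne'
  have hD : (descPochhammer ℝ (n + 1)).eval α ≠ 0 :=
    left_ne_zero_of_mul (hdesc ▸ (Real.Gamma_pos_of_pos (by linarith)).ne')
  have hTα := (Real.rpow_pos_of_pos hT α).ne'
  rw [hexpand, intervalIntegral.integral_add
      (intervalIntegrable_sum_fun _ fun j _ => (hint j.cast_nonneg).const_mul _)
      ((hint hα0.le).const_mul _),
    intervalIntegral.integral_finsetSum fun j _ => (hint j.cast_nonneg).const_mul _]
  simp only [intervalIntegral.integral_const_mul]
  rw [Finset.sum_eq_zero fun j hj => by rw [hvanish j hj, mul_zero], hmom hα0.le, hbeta, hdesc]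
  have hfact : ((n + 1).factorial : ℝ) ≠ 0 := by positivity
  field_simp
  ring
end

section
/- Let n, k ∈ ℕ, let μ > -1 and α be real numbers with n < α ≤ n+1, let T > 0, t₀ ∈ ℝ, and let a₀, …, a_n, b be real numbers. Define x_α(t₀+t) := Σ_{j=0}^{n} (t^j/j!) a_j + (t^α/Γ(α+1)) b for t ≥ 0, and let K(τ) denote the (n+1)-th derivative of the function τ ↦ (1-τ)^{n+μ+1} τ^{n+k+1}. Then ∫_0^1 K(τ) x_α(t₀+Tτ) dτ = (-1)^{n+1} T^α (B(α+1+k, n+μ+2)/Γ(α-n)) b. -/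
open Real

open MeasureTheory

theorem intervalIntegrable_one_sub_rpow_mul_rpow {s p : ℝ} (hs : -1 < s) (hp : -1 < p) :
    IntervalIntegrable (fun τ : ℝ => (1 - τ) ^ s * τ ^ p) volume 0 1 := by
  have h := Complex.betaIntegral_convergent (u := ((p + 1 : ℝ) : ℂ)) (v := ((s + 1 : ℝ) : ℂ))
    (by rw [Complex.ofReal_re]; linarith) (by rw [Complex.ofReal_re]; linarith)
  have h' : IntervalIntegrable (fun τ : ℝ => (((1 - τ) ^ s * τ ^ p : ℝ) : ℂ)) volume 0 1 := by
    refine h.congr_uIoo fun τ hτ => ?_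
    rw [Set.uIoo_of_le zero_le_one] at hτ
    simp only [Complex.ofReal_mul, Complex.ofReal_cpow hτ.1.le,
      Complex.ofReal_cpow (sub_nonneg.2 hτ.2.le)]
    push_cast
    rw [add_sub_cancel_right, add_sub_cancel_right, mul_comm]
  rw [intervalIntegrable_iff] at h' ⊢
  exact h'.re

theorem integral_one_sub_rpow_mul_rpow {s p : ℝ} (hs : -1 < s) (hp : -1 < p) :
    ∫ τ in (0 : ℝ)..1, (1 - τ) ^ s * τ ^ p = betaFn (p + 1) (s + 1) := by
  have h : ((∫ τ in (0 : ℝ)..1, (1 - τ) ^ s * τ ^ p : ℝ) : ℂ)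
      = Complex.betaIntegral ((p + 1 : ℝ) : ℂ) ((s + 1 : ℝ) : ℂ) := by
    rw [← intervalIntegral.integral_ofReal, Complex.betaIntegral]
    refine intervalIntegral.integral_congr_uIoo fun τ hτ => ?_
    rw [Set.uIoo_of_le zero_le_one] at hτ
    simp only [Complex.ofReal_mul, Complex.ofReal_cpow hτ.1.le,
      Complex.ofReal_cpow (sub_nonneg.2 hτ.2.le)]
    push_cast
    rw [add_sub_cancel_right, add_sub_cancel_right, mul_comm]
  have h2 := ProbabilityTheory.beta_eq_betaIntegralReal (p + 1) (s + 1)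
    (by linarith) (by linarith)
  rw [← h, Complex.ofReal_re] at h2
  exact h2.symm

theorem mul_betaFn_add_one_left {q s : ℝ} (hq : q ≠ 0) (hs : s ≠ 0) :
    s * betaFn (q + 1) s = q * betaFn q (s + 1) := by
  rw [betaFn, betaFn, Real.Gamma_add_one hq, Real.Gamma_add_one hs, add_right_comm, add_assoc q s 1]
  ring

theorem Gamma_add_one_eq_prod_mul_Gamma_sub (n : ℕ) {α : ℝ} (h : (n : ℝ) < α) :
    Real.Gamma (α + 1) = (∏ i ∈ Finset.range (n + 1), (α - i)) * Real.Gamma (α - n) := by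
  induction n with
  | zero =>
    simp only [Nat.cast_zero] at h
    simp [Real.Gamma_add_one h.ne']
  | succ n ih =>
    push_cast at h ⊢
    rw [ih (by linarith), Finset.prod_range_succ _ (n + 1)]
    have := Real.Gamma_add_one (s := α - (n + 1)) (by linarith)
    rw [show α - (n + 1) + 1 = α - n by ring] at this
    rw [this]
    push_cast
    ring

theorem contDiffAt_one_sub_rpow_mul_pow (N m : ℕ) (s : ℝ) {τ : ℝ} (hτ : τ < 1) :
    ContDiffAt ℝ N (fun τ : ℝ => (1 - τ) ^ s * τ ^ m) τ :=
  ((contDiffAt_const.sub contDiffAt_id).rpow_const_of_ne (sub_pos.2 hτ).ne').mul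
    (contDiffAt_id.pow m)

theorem iteratedDeriv_succ_one_sub_rpow_mul_pow_succ (N m : ℕ) (s : ℝ) {τ : ℝ} (hτ : τ < 1) :
    iteratedDeriv (N + 1) (fun τ : ℝ => (1 - τ) ^ s * τ ^ (m + 1)) τ
      = -s * iteratedDeriv N (fun τ : ℝ => (1 - τ) ^ (s - 1) * τ ^ (m + 1)) τ
        + (m + 1) * iteratedDeriv N (fun τ : ℝ => (1 - τ) ^ s * τ ^ m) τ := by
  have h : deriv (fun τ : ℝ => (1 - τ) ^ s * τ ^ (m + 1)) =ᶠ[nhds τ] fun τ =>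
      -s * ((1 - τ) ^ (s - 1) * τ ^ (m + 1)) + (m + 1) * ((1 - τ) ^ s * τ ^ m) := by
    filter_upwards [Iio_mem_nhds hτ] with x hx
    have h1 := ((hasDerivAt_id x).const_sub 1).rpow_const (p := s)
      (Or.inl (sub_pos.2 hx).ne')
    have h2 := h1.mul (hasDerivAt_pow (m + 1) x)
    refine (h2.deriv).trans ?_
    simp only [id, Nat.add_sub_cancel]
    push_cast
    ring
  rw [iteratedDeriv_succ', h.iteratedDeriv_eq, iteratedDeriv_fun_add,
    iteratedDeriv_const_mul_field, iteratedDeriv_const_mul_field]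
  · exact contDiffAt_const.mul (contDiffAt_one_sub_rpow_mul_pow N (m + 1) (s - 1) hτ)
  · exact contDiffAt_const.mul (contDiffAt_one_sub_rpow_mul_pow N m s hτ)

theorem integral_iteratedDeriv_one_sub_rpow_mul_pow_mul_rpow (N : ℕ) {m : ℕ} {s β : ℝ}
    (hm : N ≤ m) (hs : (N : ℝ) - 1 < s) (hβ : -1 < β) :
    IntervalIntegrable
      (fun τ => iteratedDeriv N (fun τ : ℝ => (1 - τ) ^ s * τ ^ m) τ * τ ^ β) volume 0 1 ∧
    ∫ τ in (0 : ℝ)..1, iteratedDeriv N (fun τ : ℝ => (1 - τ) ^ s * τ ^ m) τ * τ ^ β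
      = (-1) ^ N * (∏ i ∈ Finset.range N, (β - i)) * betaFn (m + β - N + 1) (s + 1) := by
  induction N generalizing m s with
  | zero =>
    simp only [Nat.cast_zero, zero_sub] at hs
    have hp : -1 < (m : ℝ) + β := by have : (0 : ℝ) ≤ m := m.cast_nonneg; linarith
    have h : Set.EqOn (fun τ : ℝ => (1 - τ) ^ s * τ ^ ((m : ℝ) + β))
        (fun τ => iteratedDeriv 0 (fun τ : ℝ => (1 - τ) ^ s * τ ^ m) τ * τ ^ β)
        (Set.uIoo 0 1) := by
      intro τ hτ
      rw [Set.uIoo_of_le zero_le_one] at hτ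
      simp only [iteratedDeriv_zero]
      rw [rpow_add hτ.1, rpow_natCast, mul_assoc]
    refine ⟨(intervalIntegrable_one_sub_rpow_mul_rpow hs hp).congr_uIoo h, ?_⟩
    rw [← intervalIntegral.integral_congr_uIoo h, integral_one_sub_rpow_mul_rpow hs hp]
    simp
  | succ N ih =>
    obtain ⟨m, rfl⟩ : ∃ m', m = m' + 1 := ⟨m - 1, by omega⟩
    have hNm : N ≤ m := by omega
    have hNm' : (N : ℝ) ≤ m := by exact_mod_cast hNm
    have hN : (0 : ℝ) ≤ N := N.cast_nonneg
    push_cast at hs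
    obtain ⟨i₁, e₁⟩ := ih (m := m + 1) (s := s - 1) (by omega) (by linarith)
    obtain ⟨i₂, e₂⟩ := ih (m := m) (s := s) hNm (by linarith)
    have h : Set.EqOn
        (fun τ => -s * (iteratedDeriv N (fun τ : ℝ => (1 - τ) ^ (s - 1) * τ ^ (m + 1)) τ * τ ^ β)
          + (m + 1) * (iteratedDeriv N (fun τ : ℝ => (1 - τ) ^ s * τ ^ m) τ * τ ^ β))
        (fun τ => iteratedDeriv (N + 1) (fun τ : ℝ => (1 - τ) ^ s * τ ^ (m + 1)) τ * τ ^ β)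
        (Set.uIoo 0 1) := by
      intro τ hτ
      rw [Set.uIoo_of_le zero_le_one] at hτ
      simp only [iteratedDeriv_succ_one_sub_rpow_mul_pow_succ N m s hτ.2]
      ring
    refine ⟨((i₁.const_mul _).add (i₂.const_mul _)).congr_uIoo h, ?_⟩
    rw [← intervalIntegral.integral_congr_uIoo h, intervalIntegral.integral_add (i₁.const_mul _) (i₂.const_mul _),
      intervalIntegral.integral_const_mul, intervalIntegral.integral_const_mul, e₁, e₂, Finset.prod_range_succ]
    have hB := mul_betaFn_add_one_left (q := m + β - N + 1) (s := s) (by linarith) (by linarith)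
    push_cast
    rw [show (m : ℝ) + 1 + β - N + 1 = m + β - N + 1 + 1 by ring,
      show (m : ℝ) + 1 + β - (N + 1) + 1 = m + β - N + 1 by ring, sub_add_cancel]
    linear_combination -((-1) ^ N * ∏ i ∈ Finset.range N, (β - i)) * hB

/-- Integrating the kernel `K = ((1-τ)^{n+μ+1} τ^{n+k+1})^{(n+1)}` against the
truncated fractional Taylor model recovers `b` up to an explicit constant. -/
theorem kernel_integral_recovers_coefficient
    (n k : ℕ) (μ α : ℝ) (hμ : -1 < μ) (hα1 : (n : ℝ) < α) (hα2 : α ≤ n + 1)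
    (T : ℝ) (hT : 0 < T) (t₀ : ℝ) (a : ℕ → ℝ) (b : ℝ) (xα : ℝ → ℝ)
    (hx : ∀ t : ℝ, 0 ≤ t →
      xα (t₀ + t) = (∑ j ∈ Finset.range (n + 1), t ^ j / (Nat.factorial j) * a j)
        + t ^ α / Real.Gamma (α + 1) * b) :
    ∫ τ in (0 : ℝ)..1,
        iteratedDeriv (n + 1)
          (fun τ : ℝ => (1 - τ) ^ ((n : ℝ) + μ + 1) * τ ^ (n + k + 1)) τ
          * xα (t₀ + T * τ)
      = (-1) ^ (n + 1) * T ^ α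
          * (betaFn (α + 1 + k) (n + μ + 2) / Real.Gamma (α - n)) * b := by
  have hn : (0 : ℝ) ≤ n := n.cast_nonneg
  have hα : 0 < α := by linarith
  have key : ∀ β : ℝ, -1 < β → _ := fun β hβ =>
    integral_iteratedDeriv_one_sub_rpow_mul_pow_mul_rpow (n + 1) (m := n + k + 1)
      (s := (n : ℝ) + μ + 1) (β := β) (by omega) (by push_cast; linarith) hβ
  set K := iteratedDeriv (n + 1)
    (fun τ : ℝ => (1 - τ) ^ ((n : ℝ) + μ + 1) * τ ^ (n + k + 1))
  have hj : ∀ j : ℕ, -1 < (j : ℝ) := fun j => by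
    have : (0 : ℝ) ≤ j := j.cast_nonneg
    linarith
  have hsplit : Set.EqOn (fun τ => K τ * xα (t₀ + T * τ))
      (fun τ => (∑ j ∈ Finset.range (n + 1),
          (T ^ j / (Nat.factorial j) * a j) * (K τ * τ ^ (j : ℝ)))
        + (T ^ α / Real.Gamma (α + 1) * b) * (K τ * τ ^ α)) (Set.uIoo 0 1) := by
    intro τ hτ
    rw [Set.uIoo_of_le zero_le_one] at hτ
    simp only [hx (T * τ) (mul_nonneg hT.le hτ.1.le), mul_rpow hT.le hτ.1.le, mul_add,
      Finset.mul_sum, rpow_natCast, mul_pow]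
    congr 1
    · exact Finset.sum_congr rfl fun j _ => by ring
    · ring
  have hzero : ∀ j ∈ Finset.range (n + 1), ∫ τ in (0 : ℝ)..1,
      (T ^ j / (Nat.factorial j) * a j) * (K τ * τ ^ (j : ℝ)) = 0 := by
    intro j hjn
    rw [intervalIntegral.integral_const_mul, (key j (hj j)).2, Finset.prod_eq_zero hjn (sub_self _)]
    simp
  have hint : ∀ j ∈ Finset.range (n + 1), IntervalIntegrable
      (fun τ => (T ^ j / (Nat.factorial j) * a j) * (K τ * τ ^ (j : ℝ))) volume 0 1 :=
    fun j _ => (key j (hj j)).1.const_mul _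
  have hsum : IntervalIntegrable (fun τ => ∑ j ∈ Finset.range (n + 1),
      (T ^ j / (Nat.factorial j) * a j) * (K τ * τ ^ (j : ℝ))) volume 0 1 := by
    convert! IntervalIntegrable.sum _ hint using 1
    ext τ
    rw [Finset.sum_apply]
  obtain ⟨iα, eα⟩ := key α (by linarith)
  rw [intervalIntegral.integral_congr_uIoo hsplit, intervalIntegral.integral_add hsum
    (iα.const_mul _), intervalIntegral.integral_finsetSum hint, Finset.sum_eq_zero hzero, intervalIntegral.integral_const_mul, eα,
    Gamma_add_one_eq_prod_mul_Gamma_sub n hα1]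
  have hG : Real.Gamma (α - n) ≠ 0 := (Real.Gamma_pos_of_pos (by linarith)).ne'
  have hP : ∏ i ∈ Finset.range (n + 1), (α - i) ≠ 0 := by
    refine Finset.prod_ne_zero_iff.2 fun i hi => ?_
    have : (i : ℝ) ≤ n := by exact_mod_cast Nat.lt_succ_iff.1 (Finset.mem_range.1 hi)
    linarith
  push_cast
  rw [show (n : ℝ) + k + 1 + α - (n + 1) + 1 = α + 1 + k by ring,
    show (n : ℝ) + μ + 1 + 1 = n + μ + 2 by ring]
  field_simp
  ring
end

section
/- Let n ∈ ℕ, and let μ > -1 and k > -1 be real numbers. Then for every integer j with 0 ≤ j ≤ n, ∫_0^1 (1-τ)^μ τ^k P_{n+1}^{(μ,k)}(τ) τ^j dτ = 0, i.e., the degree-(n+1) shifted Jacobi polynomial is orthogonal on [0,1] with respect to the weight (1-τ)^μ τ^k to every monomial of degree at most n. -/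
open Real

open MeasureTheory in
theorem intervalIntegrable_rpow_mul_one_sub_rpow {a b : ℝ} (ha : 0 < a) (hb : 0 < b) :
    IntervalIntegrable (fun x : ℝ => x ^ (a - 1) * (1 - x) ^ (b - 1)) volume 0 1 := by
  have h := Complex.betaIntegral_convergent (u := a) (v := b) (by simpa) (by simpa)
  rw [intervalIntegrable_iff_integrableOn_Ioc_of_le zero_le_one] at h ⊢
  refine IntegrableOn.congr_fun h.re (fun x hx => ?_) measurableSet_Ioc
  have h1 : 0 ≤ 1 - x := sub_nonneg.2 hx.2
  have e : (x : ℂ) ^ ((a : ℂ) - 1) * (1 - (x : ℂ)) ^ ((b : ℂ) - 1) =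
      ((x ^ (a - 1) * (1 - x) ^ (b - 1) : ℝ) : ℂ) := by
    push_cast [Complex.ofReal_cpow hx.1.le, Complex.ofReal_cpow h1]
    rfl
  simp only [e, RCLike.re_to_complex, Complex.ofReal_re]

theorem integral_rpow_mul_one_sub_rpow {a b : ℝ} (ha : 0 < a) (hb : 0 < b) :
    ∫ x in (0 : ℝ)..1, x ^ (a - 1) * (1 - x) ^ (b - 1) =
      Real.Gamma a * Real.Gamma b / Real.Gamma (a + b) := by
  have h := ProbabilityTheory.beta_eq_betaIntegralReal a b ha hb
  rw [ProbabilityTheory.beta] at h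
  rw [h, Complex.betaIntegral, ← Complex.ofReal_re (∫ x in (0 : ℝ)..1, _),
    ← intervalIntegral.integral_ofReal]
  congr 1
  refine intervalIntegral.integral_congr fun x hx => ?_
  rw [Set.uIcc_of_le zero_le_one] at hx
  have h1 : 0 ≤ 1 - x := sub_nonneg.2 hx.2
  push_cast [Complex.ofReal_cpow hx.1, Complex.ofReal_cpow h1]
  rfl

theorem Real.Gamma_add_nat_eq_ascPochhammer_mul {x : ℝ} (hx : 0 < x) (n : ℕ) :
    Real.Gamma (x + n) = (ascPochhammer ℝ n).eval x * Real.Gamma x := by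
  induction n with
  | zero => simp
  | succ n ih =>
    rw [Nat.cast_succ, ← add_assoc, Real.Gamma_add_one (by positivity), ih,
      ascPochhammer_succ_eval]
    ring

theorem sum_alternating_choose_mul_eval_eq_zero {R : Type*} [CommRing R] {P : Polynomial R} {n : ℕ}
    (hP : P.natDegree < n) (x : R) :
    ∑ i ∈ Finset.range (n + 1), (-1 : R) ^ (n - i) * (n.choose i : R) * P.eval (x + i) = 0 := by
  simpa [fwdDiff_iter_eq_sum_shift] using
    congrFun (Polynomial.fwdDiff_iter_eq_zero_of_degree_lt hP) x

theorem jacobiP_term_eq {μ k τ : ℝ} (h0 : 0 < τ) (h1 : τ < 1) (c : ℝ) (p i j : ℕ) :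
    (1 - τ) ^ μ * τ ^ k * (c * (τ - 1) ^ p * τ ^ i) * τ ^ j =
      c * (-1) ^ p * (τ ^ (k + i + j + 1 - 1) * (1 - τ) ^ (μ + p + 1 - 1)) := by
  have h1' : 0 < 1 - τ := sub_pos.2 h1
  rw [add_sub_cancel_right, add_sub_cancel_right, Real.rpow_add_natCast h0.ne',
    Real.rpow_add_natCast h0.ne', Real.rpow_add_natCast h1'.ne',
    show τ - 1 = -1 * (1 - τ) by ring, mul_pow]
  ring

theorem jacobiP_coeff_mul_beta_eq {μ k : ℝ} (hμ : -1 < μ) (hk : -1 < k) {m i : ℕ} (hi : i ≤ m)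
    (j : ℕ) :
    gbinom (m + μ) i * gbinom (m + k) (m - i) * (-1) ^ (m - i) *
      (Real.Gamma (k + i + j + 1) * Real.Gamma (μ + (m - i : ℕ) + 1) /
        Real.Gamma (k + i + j + 1 + (μ + (m - i : ℕ) + 1))) =
      Real.Gamma (m + μ + 1) * Real.Gamma (m + k + 1) /
          (m.factorial * Real.Gamma (k + μ + m + j + 2)) *
        ((-1) ^ (m - i) * (m.choose i : ℝ) *
          (ascPochhammer ℝ j).eval (k + 1 + i)) := by
  have hk' : 0 < k + 1 + i := by have := i.cast_nonneg (α := ℝ); linarith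
  have hμ' : 0 < μ + (m - i : ℕ) + 1 := by
    have := (m - i).cast_nonneg (α := ℝ); linarith
  have hG1 := (Real.Gamma_pos_of_pos hk').ne'
  have hG2 := (Real.Gamma_pos_of_pos hμ').ne'
  have hf1 : (i.factorial : ℝ) ≠ 0 := by positivity
  have hf2 : ((m - i).factorial : ℝ) ≠ 0 := by positivity
  have hf3 : (m.factorial : ℝ) ≠ 0 := by positivity
  rw [Nat.cast_choose ℝ hi, gbinom, gbinom, Real.Gamma_nat_eq_factorial,
    Real.Gamma_nat_eq_factorial,
    show k + i + j + 1 = k + 1 + i + j by ring, Real.Gamma_add_nat_eq_ascPochhammer_mul hk',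
    show k + 1 + i + j + (μ + (m - i : ℕ) + 1) = k + μ + m + j + 2 by
      rw [Nat.cast_sub hi]; ring,
    show (m : ℝ) + μ - i + 1 = μ + (m - i : ℕ) + 1 by rw [Nat.cast_sub hi]; ring,
    show (m : ℝ) + k - (m - i : ℕ) + 1 = k + 1 + i by rw [Nat.cast_sub hi]; ring]
  field_simp

/-- The degree-`(n+1)` shifted Jacobi polynomial is orthogonal on `[0,1]` with
respect to the weight `(1-τ)^μ τ^k` to every monomial of degree at most `n`. -/
theorem jacobi_orthogonal_to_low_degree_monomials
    (n : ℕ) (μ k : ℝ) (hμ : -1 < μ) (hk : -1 < k) :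
    ∀ j : ℕ, j ≤ n →
      ∫ τ in (0 : ℝ)..1, (1 - τ) ^ μ * τ ^ k * jacobiP μ k (n + 1) τ * τ ^ j = 0 := by
  intro j hj
  have ha (i : ℕ) : 0 < k + i + j + 1 := by
    have := i.cast_nonneg (α := ℝ); have := j.cast_nonneg (α := ℝ); linarith
  have hb (p : ℕ) : 0 < μ + p + 1 := by
    have := p.cast_nonneg (α := ℝ); linarith
  have hexpand : ∫ τ in (0 : ℝ)..1, (1 - τ) ^ μ * τ ^ k * jacobiP μ k (n + 1) τ * τ ^ j =
      ∫ τ in (0 : ℝ)..1, ∑ i ∈ Finset.range (n + 1 + 1),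
        gbinom ((n + 1 : ℕ) + μ) i * gbinom ((n + 1 : ℕ) + k) (n + 1 - i) * (-1) ^ (n + 1 - i) *
          (τ ^ (k + i + j + 1 - 1) * (1 - τ) ^ (μ + (n + 1 - i : ℕ) + 1 - 1)) := by
    rw [intervalIntegral.integral_of_le zero_le_one, intervalIntegral.integral_of_le zero_le_one,
      MeasureTheory.integral_Ioc_eq_integral_Ioo, MeasureTheory.integral_Ioc_eq_integral_Ioo]
    refine MeasureTheory.setIntegral_congr_fun measurableSet_Ioo fun τ hτ => ?_
    simp only [jacobiP, Finset.mul_sum, Finset.sum_mul]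
    exact Finset.sum_congr rfl fun i _ => jacobiP_term_eq hτ.1 hτ.2 _ _ _ _
  rw [hexpand, intervalIntegral.integral_finsetSum fun i _ =>
    (intervalIntegrable_rpow_mul_one_sub_rpow (ha i) (hb _)).const_mul _]
  simp only [intervalIntegral.integral_const_mul, integral_rpow_mul_one_sub_rpow (ha _) (hb _)]
  rw [Finset.sum_congr rfl fun i hi =>
      jacobiP_coeff_mul_beta_eq hμ hk (Nat.lt_succ_iff.1 (Finset.mem_range.1 hi)) j,
    ← Finset.mul_sum, sum_alternating_choose_mul_eval_eq_zero, mul_zero]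
  rw [ascPochhammer_natDegree]
  exact Nat.lt_succ_of_le hj
end

section
/- (Proposition 2, operational form.) Let n, k ∈ ℕ, let μ > -1 and α be real numbers with n < α ≤ n+1, and let a₀, …, a_n, b, c be real numbers. Define X(s) := Σ_{j=0}^{n} a_j s^{-(j+1)} + b s^{-(α+1)} + c s^{-(2α-n+1)} for s > 0. Then for every s > 0, s^{-(2α+k+μ+3)} · (d/ds)[ s^{2α-n+1+k} · F(s) ] = (-1)^{n+1+k} (Γ(α+1+k)/Γ(α-n)) (α-n) b · s^{-(α+n+k+μ+4)}, where F(s) denotes the (n+k+1)-th derivative at s of the function u ↦ u^{n+1} X(u). In particular, the differential operator Π^{n+1}_{k,μ,α} = s^{-(2α+k+μ+3)} · d/ds · s^{2α-n+1+k} · d^{n+k+1}/ds^{n+k+1} · s^{n+1} annihilates all terms a_j s^{-(j+1)} and the term c s^{-(2α-n+1)}, isolating b. -/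
/-- The falling factorial of `-x` of length `m` is `(-1) ^ m * Γ(x + m) / Γ(x)`. -/
theorem descPochhammer_eval_neg_eq_Gamma_div {x : ℝ} (hx : 0 < x) (m : ℕ) :
    (descPochhammer ℝ m).eval (-x) = (-1) ^ m * (Real.Gamma (x + m) / Real.Gamma x) := by
  induction m with
  | zero => simp [(Real.Gamma_pos_of_pos hx).ne']
  | succ m ih =>
    have hne : x + m ≠ 0 := by positivity
    rw [descPochhammer_succ_eval, ih, Nat.cast_succ, ← add_assoc, Real.Gamma_add_one hne]
    ring

theorem iteratedDeriv_rpow_const_eq (m : ℕ) (r x : ℝ) :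
    iteratedDeriv m (fun u : ℝ => u ^ r) x = (descPochhammer ℝ m).eval r * x ^ (r - m) := by
  rw [iteratedDeriv_eq_iterate, Real.iter_deriv_rpow_const]

/-- Termwise iterated differentiation of a combination of powers: the integer powers of degree
below the order of differentiation vanish. -/
theorem iteratedDeriv_sum_rpow_add_rpow_add_rpow {n m : ℕ} (hnm : n < m) (a : ℕ → ℝ)
    (b c p q : ℝ) {x : ℝ} (hx : 0 < x) :
    iteratedDeriv m (fun u : ℝ => (∑ j ∈ Finset.range (n + 1), a j * u ^ ((n - j : ℕ) : ℝ))
        + b * u ^ p + c * u ^ q) x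
      = b * ((descPochhammer ℝ m).eval p * x ^ (p - m))
        + c * ((descPochhammer ℝ m).eval q * x ^ (q - m)) := by
  have hc (d r : ℝ) : ContDiffAt ℝ m (fun u : ℝ => d * u ^ r) x :=
    contDiffAt_const.mul (Real.contDiffAt_rpow_const_of_ne hx.ne')
  have hs : ContDiffAt ℝ m
      (fun u : ℝ => ∑ j ∈ Finset.range (n + 1), a j * u ^ ((n - j : ℕ) : ℝ)) x :=
    ContDiffAt.sum fun j _ => hc _ _
  rw [iteratedDeriv_fun_add (hs.add (hc _ _)) (hc _ _), iteratedDeriv_fun_add hs (hc _ _),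
    iteratedDeriv_fun_sum fun j _ => hc _ _]
  simp only [iteratedDeriv_const_mul_field, iteratedDeriv_rpow_const_eq]
  rw [Finset.sum_eq_zero, zero_add]
  intro j _
  rw [descPochhammer_eval_coe_nat_of_lt (by omega), zero_mul, mul_zero]

/-- Proposition 2, operational form: the differential operator
`Π^{n+1}_{k,μ,α} = s^{-(2α+k+μ+3)} ∘ d/ds ∘ s^{2α-n+1+k} ∘ d^{n+k+1}/ds^{n+k+1} ∘ s^{n+1}`
annihilates all terms `a_j s^{-(j+1)}` and the term `c s^{-(2α-n+1)}`, isolating `b`. -/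
theorem affine_annihilator_isolates_fractional_term
    (n k : ℕ) (μ α : ℝ) (hμ : -1 < μ) (hα1 : (n : ℝ) < α) (hα2 : α ≤ n + 1)
    (a : ℕ → ℝ) (b c : ℝ) :
    ∀ s : ℝ, 0 < s →
      s ^ (-(2 * α + k + μ + 3)) *
        deriv (fun s : ℝ => s ^ (2 * α - n + 1 + k) *
          iteratedDeriv (n + k + 1)
            (fun u : ℝ => u ^ ((n : ℝ) + 1) *
              ((∑ j ∈ Finset.range (n + 1), a j * u ^ (-((j : ℝ) + 1)))
                + b * u ^ (-(α + 1)) + c * u ^ (-(2 * α - n + 1)))) s) s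
      = (-1) ^ (n + 1 + k) * (Real.Gamma (α + 1 + k) / Real.Gamma (α - n))
          * (α - n) * b * s ^ (-(α + n + k + μ + 4)) := by
  intro s hs
  set m := n + k + 1 with hm
  have hmR : (m : ℝ) = n + k + 1 := by rw [hm]; push_cast; ring
  have hX : Set.EqOn
      (fun u : ℝ => u ^ ((n : ℝ) + 1) *
        ((∑ j ∈ Finset.range (n + 1), a j * u ^ (-((j : ℝ) + 1)))
          + b * u ^ (-(α + 1)) + c * u ^ (-(2 * α - n + 1))))
      (fun u : ℝ => (∑ j ∈ Finset.range (n + 1), a j * u ^ ((n - j : ℕ) : ℝ))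
        + b * u ^ (-(α - n)) + c * u ^ (2 * n - 2 * α)) (Set.Ioi 0) := by
    intro u (hu : 0 < u)
    simp only [mul_add, Finset.mul_sum, mul_left_comm (u ^ ((n : ℝ) + 1)), ← Real.rpow_add hu]
    congr 1
    · congr 1
      · refine Finset.sum_congr rfl fun j hj => ?_
        rw [Nat.cast_sub (by simpa [Nat.lt_succ_iff] using hj)]
        congr 2
        ring
      · congr 2
        ring
    · congr 2
      ring
  have hF : (fun s : ℝ => s ^ (2 * α - n + 1 + k) *
        iteratedDeriv m (fun u : ℝ => u ^ ((n : ℝ) + 1) *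
          ((∑ j ∈ Finset.range (n + 1), a j * u ^ (-((j : ℝ) + 1)))
            + b * u ^ (-(α + 1)) + c * u ^ (-(2 * α - n + 1)))) s)
      =ᶠ[nhds s] fun x : ℝ => b * (descPochhammer ℝ m).eval (-(α - n)) * x ^ (α - n)
        + c * (descPochhammer ℝ m).eval (2 * n - 2 * α) := by
    filter_upwards [Ioi_mem_nhds hs] with x hx
    have hx' : 0 < x := hx
    rw [(hX.eventuallyEq_of_mem (Ioi_mem_nhds hx')).iteratedDeriv_eq m,
      iteratedDeriv_sum_rpow_add_rpow_add_rpow (by omega) a b c _ _ hx', mul_add]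
    simp only [mul_left_comm (x ^ (2 * α - n + 1 + k)), ← Real.rpow_add hx', hmR]
    rw [show 2 * α - n + 1 + k + (-(α - n) - (n + k + 1)) = α - n by ring,
      show 2 * α - n + 1 + k + (2 * n - 2 * α - (n + k + 1)) = 0 by ring, Real.rpow_zero]
    ring
  rw [hF.deriv_eq, deriv_add_const, deriv_const_mul_field, Real.deriv_rpow_const,
    descPochhammer_eval_neg_eq_Gamma_div (sub_pos.2 hα1), hmR,
    show α - n + (n + k + 1) = α + 1 + k by ring,
    show -(α + n + k + μ + 4) = -(2 * α + k + μ + 3) + (α - n - 1) by ring,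
    Real.rpow_add hs, hm, show n + 1 + k = n + k + 1 by ring]
  ring
end

section
/- Let n, k ∈ ℕ, let μ > -1 and α be real numbers with n < α ≤ n+1, and set λ := (2α-n+1+k)/(α-n). Then λ · (Γ(α-n)/B(α+1+k, n+μ+3)) · ∫_0^1 (1-τ)^{μ+1} τ^{k+2α-n} P_{n+1}^{(μ+1,k)}(τ) dτ + (1-λ) · (Γ(α-n)/B(α+2+k, n+μ+2)) · ∫_0^1 (1-τ)^{μ} τ^{k+1+2α-n} P_{n+1}^{(μ,k+1)}(τ) dτ = 0; i.e., the affine combination of minimal Jacobi fractional differentiators with weight λ annihilates the monomial t^{2α-n}. -/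
open Real

open MeasureTheory

theorem choose_succ_mul (a : ℝ) (i : ℕ) :
    Ring.choose a (i + 1) * (i + 1) = Ring.choose a i * (a - i) := by
  have h := Ring.choose_smul_choose a (Nat.le_succ i)
  simp only [Nat.succ_eq_add_one, Nat.choose_succ_self_right, nsmul_eq_mul,
    Nat.add_sub_cancel_left, Ring.choose_one_right] at h
  push_cast at h
  linarith

theorem gbinom_eq_choose (a : ℝ) (i : ℕ) (h : 0 < a - i + 1) :
    gbinom a i = Ring.choose a i := by
  induction i with
  | zero =>
    have : Real.Gamma (a + 1) ≠ 0 := (Real.Gamma_pos_of_pos (by simpa using h)).ne'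
    simp [gbinom, this]
  | succ i ih =>
    push_cast at h
    have hai : 0 < a - i := by linarith
    have hi : (0 : ℝ) < i + 1 := by positivity
    have h1 := choose_succ_mul a i
    rw [← ih (by linarith), gbinom, Real.Gamma_add_one hai.ne'] at h1
    have h2 : Real.Gamma (a - i) ≠ 0 := (Real.Gamma_pos_of_pos hai).ne'
    have h3 : Real.Gamma (i + 1 : ℝ) ≠ 0 := (Real.Gamma_pos_of_pos hi).ne'
    rw [gbinom]
    push_cast
    rw [Real.Gamma_add_one hi.ne', show a - (i + 1) + 1 = a - i by ring]
    refine mul_right_cancel₀ hi.ne' (Eq.trans ?_ h1.symm)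
    field_simp

theorem Gamma_add_nat (p : ℝ) (hp : 0 < p) (j : ℕ) :
    Real.Gamma (p + j) = Real.Gamma p * Real.Gamma (j + 1) * (-1) ^ j * Ring.choose (-p) j := by
  induction j with
  | zero => simp
  | succ j ih =>
    have hj : (0 : ℝ) < j + 1 := by positivity
    have hpj : 0 < p + j := by positivity
    push_cast
    rw [← add_assoc, Real.Gamma_add_one hpj.ne', ih, Real.Gamma_add_one hj.ne', pow_succ]
    linear_combination
      (-(Real.Gamma p * Real.Gamma (j + 1) * (-1) ^ j)) * -choose_succ_mul (-p) j

theorem ofReal_beta_kernel (u v : ℝ) {x : ℝ} (hx : x ∈ Set.uIoc (0 : ℝ) 1) :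
    (x : ℂ) ^ ((u : ℂ) - 1) * (1 - (x : ℂ)) ^ ((v : ℂ) - 1) =
      ((x ^ (u - 1) * (1 - x) ^ (v - 1) : ℝ) : ℂ) := by
  rw [Set.uIoc_of_le zero_le_one] at hx
  rw [Complex.ofReal_mul, Complex.ofReal_cpow hx.1.le,
    Complex.ofReal_cpow (sub_nonneg.2 hx.2)]
  push_cast
  rfl

theorem intervalIntegrable_beta_kernel (u v : ℝ) (hu : 0 < u) (hv : 0 < v) :
    IntervalIntegrable (fun x : ℝ => x ^ (u - 1) * (1 - x) ^ (v - 1)) volume 0 1 := by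
  have h := (Complex.betaIntegral_convergent (u := u) (v := v) (by simpa) (by simpa)).congr
    (fun x hx => ofReal_beta_kernel u v hx)
  rw [intervalIntegrable_iff, IntegrableOn] at h ⊢
  simpa using h.re

theorem integral_beta_kernel (u v : ℝ) (hu : 0 < u) (hv : 0 < v) :
    ∫ x in (0 : ℝ)..1, x ^ (u - 1) * (1 - x) ^ (v - 1) = betaFn u v := by
  change _ = ProbabilityTheory.beta u v
  rw [ProbabilityTheory.beta_eq_betaIntegralReal u v hu hv, Complex.betaIntegral,
    intervalIntegral.integral_congr_ae
      (Filter.Eventually.of_forall fun x hx => ofReal_beta_kernel u v hx),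
    intervalIntegral.integral_ofReal, Complex.ofReal_re]

/-- The Jacobi moments in terms of the Beta function and a binomial coefficient. -/
theorem integral_weight_mul_jacobiP (M K s : ℝ) (m : ℕ) (hM : -1 < M) (hK : -1 < K)
    (hs : -1 < s) :
    ∫ τ in (0 : ℝ)..1, (1 - τ) ^ M * τ ^ s * jacobiP M K m τ =
      (-1) ^ m * Ring.choose (m + K - s - 1) m * betaFn (s + 1) (m + M + 1) := by
  have hexp : ∀ τ ∈ Set.Ioo (0 : ℝ) 1, (1 - τ) ^ M * τ ^ s * jacobiP M K m τ =
      ∑ j ∈ Finset.range (m + 1),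
        (gbinom (m + M) j * gbinom (m + K) (m - j) * (-1) ^ (m - j)) *
          (τ ^ ((s + j + 1) - 1) * (1 - τ) ^ ((M + (m - j : ℕ) + 1) - 1)) := by
    intro τ hτ
    rw [jacobiP, Finset.mul_sum]
    refine Finset.sum_congr rfl fun j _ => ?_
    rw [add_sub_cancel_right, add_sub_cancel_right, Real.rpow_add_natCast hτ.1.ne',
      Real.rpow_add_natCast (sub_pos.2 hτ.2).ne', ← neg_sub 1 τ, neg_pow (1 - τ)]
    ring
  have hpos : ∀ j : ℕ, 0 < s + j + 1 := fun j => by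
    have : (0 : ℝ) ≤ j := j.cast_nonneg
    linarith
  have hpos' : ∀ j : ℕ, 0 < M + j + 1 := fun j => by
    have : (0 : ℝ) ≤ j := j.cast_nonneg
    linarith
  rw [intervalIntegral.integral_of_le zero_le_one, integral_Ioc_eq_integral_Ioo,
    setIntegral_congr_fun measurableSet_Ioo hexp, ← integral_Ioc_eq_integral_Ioo,
    ← intervalIntegral.integral_of_le zero_le_one, intervalIntegral.integral_finsetSum
      fun j _ => (intervalIntegrable_beta_kernel _ _ (hpos j) (hpos' _)).const_mul _,
    show (m : ℝ) + K - s - 1 = (-(s + 1)) + (m + K) by ring,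
    Ring.add_choose_eq m (Commute.all _ _), Finset.Nat.sum_antidiagonal_eq_sum_range_succ_mk,
    Finset.mul_sum, Finset.sum_mul]
  refine Finset.sum_congr rfl fun j hj => ?_
  have hjm : j ≤ m := Nat.lt_succ_iff.1 (Finset.mem_range.1 hj)
  have hcast : ((m - j : ℕ) : ℝ) = m - j := Nat.cast_sub hjm
  have hm := hpos' (m - j)
  have hjm' : (0 : ℝ) ≤ j := j.cast_nonneg
  rw [intervalIntegral.integral_const_mul, integral_beta_kernel _ _ (hpos j) hm,
    gbinom_eq_choose (m + K) (m - j) (by rw [hcast]; linarith), gbinom, betaFn, betaFn]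
  rw [show s + j + 1 = s + 1 + j by ring, Gamma_add_nat (s + 1) (by linarith) j]
  rw [hcast] at hm ⊢
  rw [show (m : ℝ) + M - j + 1 = M + (m - j) + 1 by ring,
    show s + 1 + j + (M + (m - j) + 1) = s + 1 + (m + M + 1) by ring]
  have h1 := (Real.Gamma_pos_of_pos hm).ne'
  have h2 : Real.Gamma (j + 1 : ℝ) ≠ 0 := (Real.Gamma_pos_of_pos (by positivity)).ne'
  have h3 : Real.Gamma (s + 1 + (m + M + 1)) ≠ 0 :=
    (Real.Gamma_pos_of_pos (by have := hpos m; linarith)).ne'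
  have h4 : (-1 : ℝ) ^ m = (-1) ^ (m - j) * (-1) ^ j := by
    rw [← pow_add, Nat.sub_add_cancel hjm]
  rw [h4]
  field_simp

/-- The affine combination of minimal Jacobi fractional differentiators with weight
`λ = (2α-n+1+k)/(α-n)` annihilates the monomial `t^{2α-n}`. -/
theorem affine_combination_annihilates_second_term
    (n k : ℕ) (μ α : ℝ) (hμ : -1 < μ) (hα1 : (n : ℝ) < α) (hα2 : α ≤ n + 1) :
    (2 * α - n + 1 + k) / (α - n)
        * (Real.Gamma (α - n) / betaFn (α + 1 + k) (n + μ + 3))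
        * (∫ τ in (0 : ℝ)..1,
            (1 - τ) ^ (μ + 1) * τ ^ ((k : ℝ) + 2 * α - n) * jacobiP (μ + 1) k (n + 1) τ)
      + (1 - (2 * α - n + 1 + k) / (α - n))
          * (Real.Gamma (α - n) / betaFn (α + 2 + k) (n + μ + 2))
          * (∫ τ in (0 : ℝ)..1,
              (1 - τ) ^ μ * τ ^ ((k : ℝ) + 1 + 2 * α - n) * jacobiP μ (k + 1) (n + 1) τ)
      = 0 := by
  have hn : (0 : ℝ) ≤ n := n.cast_nonneg
  have hk : (0 : ℝ) ≤ k := k.cast_nonneg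
  have hαn : α - n ≠ 0 := by linarith
  have hq : 0 < 2 * α - n + 1 + k := by linarith
  have hp : 0 < α + 1 + k := by linarith
  rw [integral_weight_mul_jacobiP _ _ _ _ (by linarith) (by linarith) (by linarith),
    integral_weight_mul_jacobiP _ _ _ _ hμ (by linarith) (by linarith)]
  push_cast
  rw [show (n : ℝ) + 1 + (k + 1) - (k + 1 + 2 * α - n) - 1 = n + 1 + k - (k + 2 * α - n) - 1 by ring,
    show (k : ℝ) + 2 * α - n + 1 = 2 * α - n + 1 + k by ring,
    show (k : ℝ) + 1 + 2 * α - n + 1 = 2 * α - n + 1 + k + 1 by ring,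
    show (n : ℝ) + 1 + (μ + 1) + 1 = n + μ + 3 by ring,
    show (n : ℝ) + 1 + μ + 1 = n + μ + 2 by ring,
    show α + 2 + k = α + 1 + k + 1 by ring]
  simp only [betaFn]
  rw [Real.Gamma_add_one hq.ne', Real.Gamma_add_one hp.ne',
    show α + 1 + k + 1 + (n + μ + 2) = α + 1 + k + (n + μ + 3) by ring,
    show 2 * α - n + 1 + k + 1 + (n + μ + 2) = 2 * α - n + 1 + k + (n + μ + 3) by ring]
  have h1 := (Real.Gamma_pos_of_pos hp).ne'
  have h2 : Real.Gamma (n + μ + 2) ≠ 0 := (Real.Gamma_pos_of_pos (by linarith)).ne'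
  have h3 : Real.Gamma (n + μ + 3) ≠ 0 := (Real.Gamma_pos_of_pos (by linarith)).ne'
  have h4 : Real.Gamma (α + 1 + k + (n + μ + 3)) ≠ 0 :=
    (Real.Gamma_pos_of_pos (by linarith)).ne'
  have h5 : Real.Gamma (2 * α - n + 1 + k + (n + μ + 3)) ≠ 0 :=
    (Real.Gamma_pos_of_pos (by linarith)).ne'
  have hl : 1 - (2 * α - n + 1 + k) / (α - n) = -((α + 1 + k) / (α - n)) := by
    field_simp
    ring
  rw [hl]
  generalize (2 * α - n + 1 + k) = q at *
  generalize (α + 1 + k) = p at *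
  field_simp
  ring
end
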